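/- arXiv:2008.04904 — 4 statements merged into one kernel-verified Lean document; each statement's English description precedes it below -/
import Mathlib

section
/- Let q > 1, 0 < α ≤ 1, and for each natural number k define the coefficient a(k) = ∏_{m=0}^{k-1} (q^{-mα-1} - 1) (with a(0) = 1 as the empty product). Then for every real t ≥ 0 the series ∑_{k=0}^∞ a(k) · t^{kα} / Γ(kα + 1) is convergent (the family k ↦ a(k) t^{kα}/Γ(kα+1) is summable). -/
/-- For `x, c ≥ 0`, the Gamma function dominates the exponential `c ^ x` up to a constant. -/
theorem rpow_mul_exp_neg_le_Gamma_add_one {x c : ℝ} (hx : 0 ≤ x) (hc : 0 ≤ c) :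
    c ^ x * Real.exp (-c) ≤ Real.Gamma (x + 1) := by
  have hint := Real.GammaIntegral_convergent (s := x + 1) (by linarith)
  have hsub : Set.Ioi c ⊆ Set.Ioi (0 : ℝ) := Set.Ioi_subset_Ioi hc
  rw [Real.Gamma_eq_integral (by linarith), ← integral_exp_neg_Ioi, ← MeasureTheory.integral_const_mul]
  refine (MeasureTheory.setIntegral_mono_on ((integrableOn_exp_neg_Ioi c).const_mul _)
    (hint.mono_set hsub) measurableSet_Ioi fun s hs => ?_).trans
    (MeasureTheory.setIntegral_mono_set hint ?_ hsub.eventuallyLE)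
  · rw [add_sub_cancel_right, mul_comm]
    have : c ^ x ≤ s ^ x := Real.rpow_le_rpow hc (le_of_lt hs) hx
    gcongr
  · filter_upwards [MeasureTheory.ae_restrict_mem measurableSet_Ioi] with s hs
    exact mul_nonneg (Real.exp_pos _).le (Real.rpow_nonneg (le_of_lt hs) _)

/-- The Mittag-Leffler series with unit coefficients converges at every nonnegative real. -/
theorem summable_rpow_div_Gamma {α t : ℝ} (hα : 0 < α) (ht : 0 ≤ t) :
    Summable fun k : ℕ => t ^ ((k : ℝ) * α) / Real.Gamma ((k : ℝ) * α + 1) := by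
  have hr : (t / (t + 1)) ^ α < 1 :=
    Real.rpow_lt_one (by positivity) ((div_lt_one (by linarith)).2 (by linarith)) hα
  refine Summable.of_nonneg_of_le (fun k => ?_) (fun k => ?_)
    ((summable_geometric_of_lt_one (by positivity) hr).mul_left (Real.exp (t + 1)))
  · have := Real.Gamma_pos_of_pos (s := (k : ℝ) * α + 1) (by positivity)
    positivity
  · have hG := rpow_mul_exp_neg_le_Gamma_add_one (x := k * α) (c := t + 1)
      (by positivity) (by linarith)
    calc t ^ ((k : ℝ) * α) / Real.Gamma (k * α + 1)
        ≤ t ^ ((k : ℝ) * α) / ((t + 1) ^ ((k : ℝ) * α) * Real.exp (-(t + 1))) := by gcongr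
      _ = Real.exp (t + 1) * ((t / (t + 1)) ^ α) ^ k := by
        rw [← Real.rpow_natCast, ← Real.rpow_mul (by positivity), mul_comm α,
          Real.div_rpow ht (by linarith), Real.exp_neg]
        field_simp

/-- For `q > 1`, `0 < α ≤ 1`, and coefficients
`a k = ∏_{m=0}^{k-1} (q^{-mα-1} - 1)`, the series
`∑_k a k * t^(kα) / Γ(kα+1)` is summable for every real `t ≥ 0`. -/
theorem ambartsumian_series_summable (q α : ℝ) (hq : 1 < q) (hα0 : 0 < α) (hα1 : α ≤ 1)
    (t : ℝ) (ht : 0 ≤ t) :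
    Summable (fun k : ℕ =>
      (∏ m ∈ Finset.range k, (q ^ (-(m : ℝ) * α - 1) - 1)) *
        t ^ ((k : ℝ) * α) / Real.Gamma ((k : ℝ) * α + 1)) := by
  refine Summable.of_norm_bounded (summable_rpow_div_Gamma hα0 ht) fun k => ?_
  have hG := Real.Gamma_pos_of_pos (s := (k : ℝ) * α + 1) (by positivity)
  have hprod : ‖∏ m ∈ Finset.range k, (q ^ (-(m : ℝ) * α - 1) - 1)‖ ≤ 1 := by
    rw [norm_prod]
    refine Finset.prod_le_one (fun _ _ => norm_nonneg _) fun m _ => ?_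
    have hpos : 0 < q ^ (-(m : ℝ) * α - 1) := Real.rpow_pos_of_pos (by linarith) _
    have hle : q ^ (-(m : ℝ) * α - 1) ≤ 1 :=
      Real.rpow_le_one_of_one_le_of_nonpos hq.le (by nlinarith [mul_nonneg m.cast_nonneg hα0.le])
    rw [Real.norm_eq_abs, abs_le]
    constructor <;> linarith
  have hnonneg : 0 ≤ t ^ ((k : ℝ) * α) / Real.Gamma ((k : ℝ) * α + 1) := by positivity
  rw [mul_div_assoc, norm_mul, Real.norm_of_nonneg hnonneg]
  exact mul_le_of_le_one_left hnonneg hprod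
end

section
/- Let q > 1, b(k) = ∏_{m=0}^{k-1} (q^{-m-1} - 1), λ ∈ ℝ, and define F(t) = λ · ∑_{k=0}^∞ b(k) t^k / k! for t ∈ ℝ. Then F(0) = λ and F satisfies the Ambartsumian delay differential equation: for every real t, F'(t) = -F(t) + (1/q) F(t/q). -/
theorem mul_pow_pred_div_factorial_succ (k : ℕ) (x : ℝ) :
    (↑(k + 1) * x ^ (k + 1 - 1)) / (Nat.factorial (k + 1) : ℝ) = x ^ k / (Nat.factorial k : ℝ) := by
  rw [Nat.factorial_succ, Nat.cast_mul, Nat.add_sub_cancel]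
  exact mul_div_mul_left _ _ (by positivity)

theorem summable_mul_pow_div_factorial {a : ℕ → ℝ} {C : ℝ} (ha : ∀ k, |a k| ≤ C) (t : ℝ) :
    Summable fun k : ℕ => a k * t ^ k / (Nat.factorial k : ℝ) := by
  refine .of_norm_bounded ((Real.summable_pow_div_factorial |t|).mul_left C) fun k => ?_
  rw [Real.norm_eq_abs, abs_div, abs_mul, abs_pow, Nat.abs_cast, mul_div_assoc]
  gcongr
  exact ha k

/-- An exponential generating series with bounded coefficients may be differentiated term by term,
which shifts the coefficients. -/
theorem hasDerivAt_tsum_mul_pow_div_factorial {a : ℕ → ℝ} {C : ℝ} (ha : ∀ k, |a k| ≤ C) (t : ℝ) :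
    HasDerivAt (fun s : ℝ => ∑' k : ℕ, a k * s ^ k / (Nat.factorial k : ℝ))
      (∑' k : ℕ, a (k + 1) * t ^ k / (Nat.factorial k : ℝ)) t := by
  set R := |t| + 1
  have hu : Summable fun k : ℕ => C * ((k * R ^ (k - 1)) / (Nat.factorial k : ℝ)) := by
    refine Summable.mul_left C ((summable_nat_add_iff 1).mp ?_)
    simpa only [mul_pow_pred_div_factorial_succ] using Real.summable_pow_div_factorial R
  have hbound : ∀ (k : ℕ) (y : ℝ), y ∈ Metric.ball (0 : ℝ) R →
      ‖a k * (k * y ^ (k - 1)) / (Nat.factorial k : ℝ)‖ ≤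
        C * ((k * R ^ (k - 1)) / (Nat.factorial k : ℝ)) := by
    intro k y hy
    have hy' : |y| ≤ R := by simpa using (mem_ball_zero_iff.mp hy).le
    rw [Real.norm_eq_abs, abs_div, abs_mul, abs_mul, abs_pow, Nat.abs_cast, Nat.abs_cast,
      mul_div_assoc]
    have hC : 0 ≤ C := (abs_nonneg _).trans (ha k)
    gcongr
    exact ha k
  have ht : t ∈ Metric.ball (0 : ℝ) R := by simp [R]
  have key := hasDerivAt_tsum_of_isPreconnected hu Metric.isOpen_ball
    (convex_ball (0 : ℝ) R).isPreconnected
    (fun k y _ => ((hasDerivAt_pow k y).const_mul (a k)).div_const (Nat.factorial k : ℝ))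
    hbound ht (summable_mul_pow_div_factorial ha t) ht
  convert! key using 1
  rw [(Summable.of_norm_bounded hu fun k => hbound k t ht).tsum_eq_zero_add]
  simp only [mul_div_assoc (a _), mul_pow_pred_div_factorial_succ]
  simp

theorem abs_prod_rpow_sub_one_le_one {q : ℝ} (hq : 1 < q) (k : ℕ) :
    |∏ m ∈ Finset.range k, (q ^ (-(m : ℝ) - 1) - 1)| ≤ 1 := by
  rw [Finset.abs_prod]
  refine Finset.prod_le_one (fun _ _ => abs_nonneg _) fun m _ => ?_
  have hpos : 0 < q ^ (-(m : ℝ) - 1) := Real.rpow_pos_of_pos (by linarith) _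
  have hle : q ^ (-(m : ℝ) - 1) ≤ 1 :=
    Real.rpow_le_one_of_one_le_of_nonpos hq.le (by linarith [m.cast_nonneg (α := ℝ)])
  rw [abs_le]
  constructor <;> linarith

/-- For `q > 1`, `λ ∈ ℝ`, the function
`F t = λ * ∑' k, b k * t^k / k!` with `b k = ∏_{m=0}^{k-1} (q^{-m-1} - 1)`
satisfies `F 0 = λ` and the Ambartsumian equation `F' t = -F t + (1/q) F (t/q)`. -/
theorem ambartsumian_series_solves (q lam : ℝ) (hq : 1 < q)
    (F : ℝ → ℝ)
    (hF : F = fun t : ℝ => lam * ∑' k : ℕ,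
      (∏ m ∈ Finset.range k, (q ^ (-(m : ℝ) - 1) - 1)) * t ^ k / (Nat.factorial k : ℝ)) :
    F 0 = lam ∧ ∀ t : ℝ, HasDerivAt F (-F t + (1 / q) * F (t / q)) t := by
  have hb := abs_prod_rpow_sub_one_le_one hq
  have hq0 : 0 < q := by linarith
  subst hF
  refine ⟨?_, fun t => ?_⟩
  · beta_reduce
    rw [tsum_eq_single 0 fun k hk => by simp [hk]]
    simp
  · convert! (hasDerivAt_tsum_mul_pow_div_factorial hb t).const_mul lam using 1
    have hpow (k : ℕ) : q ^ (-(k : ℝ) - 1) = 1 / q * (1 / q ^ k) := by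
      rw [Real.rpow_sub hq0, Real.rpow_neg hq0.le, Real.rpow_natCast, Real.rpow_one]
      field_simp
    have hsum := ((summable_mul_pow_div_factorial hb (t / q)).mul_left (1 / q)).tsum_sub
      (summable_mul_pow_div_factorial hb t)
    rw [tsum_mul_left] at hsum
    have hterm (k : ℕ) :
        (∏ m ∈ Finset.range (k + 1), (q ^ (-(m : ℝ) - 1) - 1)) * t ^ k / (Nat.factorial k : ℝ) =
          1 / q * ((∏ m ∈ Finset.range k, (q ^ (-(m : ℝ) - 1) - 1)) * (t / q) ^ k /
            (Nat.factorial k : ℝ)) -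
          (∏ m ∈ Finset.range k, (q ^ (-(m : ℝ) - 1) - 1)) * t ^ k / (Nat.factorial k : ℝ) := by
      rw [Finset.prod_range_succ, hpow k, div_pow]
      ring
    rw [tsum_congr hterm, hsum]
    ring
end

section
/- Let q > 1, λ ∈ ℝ, and b(k) = ∏_{m=0}^{k-1} (q^{-m-1} - 1). Define the Picard iterates for the Ambartsumian equation by φ_0(t) = λ and φ_k(t) = λ - ∫_0^t φ_{k-1}(s) ds + (1/q) ∫_0^t φ_{k-1}(s/q) ds for k ≥ 1. Then for every k ≥ 0 and every real t, φ_k(t) = λ · ∑_{m=0}^{k} b(m) t^m / m!. -/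
/-- Term-by-term integration of a rescaled exponential-type polynomial. -/
theorem integral_sum_mul_div_pow_div_factorial (c : ℕ → ℝ) (lam r t : ℝ) (n : ℕ) :
    ∫ s in (0 : ℝ)..t, lam * ∑ m ∈ Finset.range n, c m * (s / r) ^ m / (Nat.factorial m : ℝ) =
      lam * ∑ m ∈ Finset.range n,
        c m * (r⁻¹ ^ m * t ^ (m + 1)) / (Nat.factorial (m + 1) : ℝ) := by
  rw [intervalIntegral.integral_const_mul, intervalIntegral.integral_finsetSum]
  · congr 1
    refine Finset.sum_congr rfl fun m _ => ?_
    simp only [div_eq_mul_inv, mul_pow]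
    rw [intervalIntegral.integral_mul_const, intervalIntegral.integral_const_mul,
      intervalIntegral.integral_mul_const, integral_pow, Nat.factorial_succ]
    have hm : (m : ℝ) + 1 ≠ 0 := by positivity
    have hf : (Nat.factorial m : ℝ) ≠ 0 := by positivity
    push_cast
    field_simp
    simp
  · intro m _
    apply Continuous.intervalIntegrable
    fun_prop

/-- The Picard iterates `φ_0 t = λ`,
`φ_k t = λ - ∫_0^t φ_{k-1}(s) ds + (1/q) ∫_0^t φ_{k-1}(s/q) ds` for the
Ambartsumian equation satisfy `φ_k t = λ * ∑_{m=0}^{k} b m * t^m / m!`,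
where `b m = ∏_{j=0}^{m-1} (q^{-j-1} - 1)`. -/
theorem ambartsumian_picard_iterates (q lam : ℝ) (hq : 1 < q)
    (φ : ℕ → ℝ → ℝ)
    (h0 : ∀ t : ℝ, φ 0 t = lam)
    (hrec : ∀ k : ℕ, ∀ t : ℝ, φ (k + 1) t =
      lam - (∫ s in (0 : ℝ)..t, φ k s) + (1 / q) * ∫ s in (0 : ℝ)..t, φ k (s / q)) :
    ∀ k : ℕ, ∀ t : ℝ, φ k t = lam * ∑ m ∈ Finset.range (k + 1),
      (∏ j ∈ Finset.range m, (q ^ (-(j : ℝ) - 1) - 1)) * t ^ m / (Nat.factorial m : ℝ) := by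
  intro k
  induction k with
  | zero => intro t; simp [h0]
  | succ k ih =>
    intro t
    have hq0 : 0 < q := by linarith
    have hpow : ∀ m : ℕ, q ^ (-(m : ℝ) - 1) = 1 / q * q⁻¹ ^ m := fun m => by
      rw [Real.rpow_sub_one hq0.ne', Real.rpow_neg hq0.le, Real.rpow_natCast, inv_pow]
      ring
    rw [hrec, Finset.sum_range_succ']
    simp only [ih]
    have h1 := integral_sum_mul_div_pow_div_factorial
      (fun m => ∏ j ∈ Finset.range m, (q ^ (-(j : ℝ) - 1) - 1)) lam 1 t (k + 1)
    simp only [div_one, inv_one, one_pow, one_mul] at h1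
    rw [h1, integral_sum_mul_div_pow_div_factorial
      (fun m => ∏ j ∈ Finset.range m, (q ^ (-(j : ℝ) - 1) - 1)) lam q t (k + 1)]
    simp only [Finset.mul_sum, mul_add, Finset.range_zero, Finset.prod_empty, pow_zero,
      Nat.factorial_zero, Nat.cast_one, mul_one, div_one]
    rw [sub_add_eq_add_sub, add_sub_assoc, ← Finset.sum_sub_distrib, add_comm]
    congr 1
    refine Finset.sum_congr rfl fun m _ => ?_
    rw [Finset.prod_range_succ, hpow m]
    ring
end

section
/- Let q > 1, 0 < α ≤ 1, and fix t > 0. With a(k) = ∏_{m=0}^{k-1} (q^{-mα-1} - 1), the ratio of consecutive terms of the series ∑_k a(k) t^{kα}/Γ(kα+1) tends to zero: (|a(k+1)| · t^{(k+1)α} / Γ((k+1)α + 1)) / (|a(k)| · t^{kα} / Γ(kα + 1)) → 0 as k → ∞. -/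
/-- One half of Wendel's inequality, a consequence of the log-convexity of `Γ`. -/
theorem Real.Gamma_add_one_mul_rpow_le {x a : ℝ} (hx : 0 ≤ x) (ha0 : 0 < a) (ha1 : a ≤ 1) :
    Real.Gamma (x + 1) * (x + a) ^ a ≤ Real.Gamma (x + a + 1) := by
  have hxa : 0 < x + a := by linarith
  have hG : 0 < Real.Gamma (x + a) := Real.Gamma_pos_of_pos hxa
  rcases ha1.eq_or_lt with rfl | ha1
  · rw [Real.Gamma_add_one hxa.ne', Real.rpow_one, mul_comm]
  · have h := Real.Gamma_mul_add_mul_le_rpow_Gamma_mul_rpow_Gamma hxa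
      (show 0 < x + a + 1 by linarith) ha0 (sub_pos.2 ha1) (by ring)
    rw [show a * (x + a) + (1 - a) * (x + a + 1) = x + 1 by ring] at h
    calc Real.Gamma (x + 1) * (x + a) ^ a
        ≤ Real.Gamma (x + a) ^ a * Real.Gamma (x + a + 1) ^ (1 - a) * (x + a) ^ a := by gcongr
      _ = (Real.Gamma (x + a) * (x + a)) ^ a * Real.Gamma (x + a + 1) ^ (1 - a) := by
          rw [Real.mul_rpow hG.le hxa.le]; ring
      _ = Real.Gamma (x + a + 1) := by
          rw [mul_comm (Real.Gamma (x + a)), ← Real.Gamma_add_one hxa.ne',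
            ← Real.rpow_add (Real.Gamma_pos_of_pos (by linarith)), add_sub_cancel, Real.rpow_one]

/-- `q ^ y - 1` is nonzero and at most `1` in absolute value when `q > 1` and `y < 0`. -/
theorem Real.abs_rpow_sub_one_mem_Ioc {q y : ℝ} (hq : 1 < q) (hy : y < 0) :
    |q ^ y - 1| ∈ Set.Ioc 0 1 := by
  have h0 : 0 < q ^ y := Real.rpow_pos_of_pos (by linarith) y
  have h1 : q ^ y < 1 := Real.rpow_lt_one_of_one_lt_of_neg hq hy
  rw [abs_of_neg (by linarith)]
  constructor <;> linarith


/-- For `q > 1`, `0 < α ≤ 1`, `t > 0`, the ratio of consecutive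
terms of the series `∑_k a k * t^(kα)/Γ(kα+1)` tends to `0` as `k → ∞`. -/
theorem ambartsumian_ratio_test (q α t : ℝ) (hq : 1 < q) (hα0 : 0 < α) (hα1 : α ≤ 1)
    (ht : 0 < t) :
    Filter.Tendsto
      (fun k : ℕ =>
        (|∏ m ∈ Finset.range (k + 1), (q ^ (-(m : ℝ) * α - 1) - 1)| *
            t ^ (((k : ℝ) + 1) * α) / Real.Gamma (((k : ℝ) + 1) * α + 1)) /
        (|∏ m ∈ Finset.range k, (q ^ (-(m : ℝ) * α - 1) - 1)| *
            t ^ ((k : ℝ) * α) / Real.Gamma ((k : ℝ) * α + 1)))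
      Filter.atTop (nhds 0) := by
  have hneg (m : ℕ) : -(m : ℝ) * α - 1 < 0 := by
    have : 0 ≤ (m : ℝ) * α := by positivity
    linarith
  have hlim : Filter.Tendsto (fun k : ℕ => t ^ α * (((k : ℝ) * α + α) ^ α)⁻¹)
      Filter.atTop (nhds 0) := by
    have h : Filter.Tendsto (fun k : ℕ => (k : ℝ) * α + α) Filter.atTop Filter.atTop :=
      Filter.tendsto_atTop_add_const_right _ _
        (tendsto_natCast_atTop_atTop.atTop_mul_const hα0)
    simpa using ((tendsto_rpow_atTop hα0).comp h).inv_tendsto_atTop.const_mul (t ^ α)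
  refine squeeze_zero (fun k => ?_) (fun k => ?_) hlim
  · have h1 : 0 < Real.Gamma (((k : ℝ) + 1) * α + 1) := Real.Gamma_pos_of_pos (by positivity)
    have h2 : 0 < Real.Gamma ((k : ℝ) * α + 1) := Real.Gamma_pos_of_pos (by positivity)
    positivity
  · have h1 : 0 < Real.Gamma ((k : ℝ) * α + α + 1) := Real.Gamma_pos_of_pos (by positivity)
    have h2 : 0 < Real.Gamma ((k : ℝ) * α + 1) := Real.Gamma_pos_of_pos (by positivity)
    have hP : 0 < |∏ m ∈ Finset.range k, (q ^ (-(m : ℝ) * α - 1) - 1)| := by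
      rw [Finset.abs_prod]
      exact Finset.prod_pos fun m _ => (Real.abs_rpow_sub_one_mem_Ioc hq (hneg m)).1
    have hc := (Real.abs_rpow_sub_one_mem_Ioc hq (hneg k)).2
    have htk : 0 < t ^ ((k : ℝ) * α) := Real.rpow_pos_of_pos ht _
    have hD : 0 < ((k : ℝ) * α + α) ^ α := Real.rpow_pos_of_pos (by positivity) _
    have hW := Real.Gamma_add_one_mul_rpow_le (x := (k : ℝ) * α) (by positivity) hα0 hα1
    rw [Finset.prod_range_succ, abs_mul, add_one_mul, Real.rpow_add ht]
    set P := |∏ m ∈ Finset.range k, (q ^ (-(m : ℝ) * α - 1) - 1)|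
    calc _ = |q ^ (-(k : ℝ) * α - 1) - 1| *
          (t ^ α * (Real.Gamma ((k : ℝ) * α + 1) / Real.Gamma ((k : ℝ) * α + α + 1))) := by
          field_simp
      _ ≤ 1 * (t ^ α * (((k : ℝ) * α + α) ^ α)⁻¹) := by
          gcongr
          rwa [div_le_iff₀ h1, inv_mul_eq_div, le_div_iff₀ hD]
      _ = _ := one_mul _
end
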